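/- For every η ∈ W = ker V*, the composition U_1(U_2(⋯(U_n η)⋯)) equals η; that is, the product of the unitary operators U_1, …, U_n is the identity operator on W. -/

import Mathlib

open ContinuousLinearMap Filter Finset

/-- Product of the commuting operators `V i` over a finite index set `s`. -/
noncomputable def opProd {H : Type*} [NormedAddCommGroup H] [InnerProductSpace ℂ H]
    {n : ℕ} (V : Fin n → H →L[ℂ] H) (hcomm : ∀ i j, Commute (V i) (V j))
    (s : Finset (Fin n)) : H →L[ℂ] H :=
  s.noncommProd V fun a _ b _ _ => hcomm a b

/-- The wandering subspace `ker ((∏_{i ∈ s} V i)^*)`. -/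
noncomputable def wSub {H : Type*} [NormedAddCommGroup H] [InnerProductSpace ℂ H] [CompleteSpace H]
    {n : ℕ} (V : Fin n → H →L[ℂ] H) (hcomm : ∀ i j, Commute (V i) (V j))
    (s : Finset (Fin n)) : Submodule ℂ H :=
  LinearMap.ker (ContinuousLinearMap.adjoint (opProd V hcomm s)).toLinearMap

/-- The orthogonal projection of `H` onto `wSub V hcomm s`, as an operator on `H`. -/
noncomputable def wProj {H : Type*} [NormedAddCommGroup H] [InnerProductSpace ℂ H] [CompleteSpace H]
    {n : ℕ} (V : Fin n → H →L[ℂ] H) (hcomm : ∀ i j, Commute (V i) (V j))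
    (s : Finset (Fin n)) : H →L[ℂ] H :=
  haveI : CompleteSpace (wSub V hcomm s) :=
    (ContinuousLinearMap.isClosed_ker _).completeSpace_coe
  (wSub V hcomm s).subtypeL ∘L Submodule.orthogonalProjectionOnto (wSub V hcomm s)

/-- The operator `U_i = P_W ∘ V_i + Ṽ_i^*`, which restricts to a unitary on `W`. -/
noncomputable def Uop {H : Type*} [NormedAddCommGroup H] [InnerProductSpace ℂ H] [CompleteSpace H]
    {n : ℕ} (V : Fin n → H →L[ℂ] H) (hcomm : ∀ i j, Commute (V i) (V j))
    (i : Fin n) : H →L[ℂ] H :=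
  (wProj V hcomm Finset.univ) ∘L V i
    + ContinuousLinearMap.adjoint (opProd V hcomm (Finset.univ.erase i))

/-- The linear relation spanned by the pairs `(T ^ k w, w)` with `w ∈ ker T^*`. When `T` is an
isometry it relates `∑ T ^ k w_k` to `∑ w_k`, that is, a polynomial to its value at `1`. -/
def evalOneRel {H : Type*} [NormedAddCommGroup H] [InnerProductSpace ℂ H] [CompleteSpace H]
    (T : H →L[ℂ] H) : Submodule ℂ (H × H) :=
  Submodule.span ℂ {p | ∃ (k : ℕ) (w : H), adjoint T w = 0 ∧ p = ((T ^ k) w, w)}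

section

variable {H : Type*} [NormedAddCommGroup H] [InnerProductSpace ℂ H]

theorem norm_opProd_apply {n : ℕ} {V : Fin n → H →L[ℂ] H} (hiso : ∀ i x, ‖V i x‖ = ‖x‖)
    (hcomm : ∀ i j, Commute (V i) (V j)) (s : Finset (Fin n)) (x : H) :
    ‖opProd V hcomm s x‖ = ‖x‖ := by
  refine noncommProd_induction s V _ (fun A : H →L[ℂ] H => ∀ x, ‖A x‖ = ‖x‖) ?_ ?_ ?_ x
  · intro A B hA hB x
    rw [mul_apply_eq_comp, hA, hB]
  · simp
  · exact fun i _ => hiso i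

variable [CompleteSpace H]

theorem pow_mem_evalOneRel {T : H →L[ℂ] H} (k : ℕ) {w : H} (hw : adjoint T w = 0) :
    ((T ^ k) w, w) ∈ evalOneRel T :=
  Submodule.subset_span ⟨k, w, hw, rfl⟩

theorem adjoint_apply_apply_of_norm_map {A : H →L[ℂ] H} (hA : ∀ x, ‖A x‖ = ‖x‖) (x : H) :
    adjoint A (A x) = x :=
  DFunLike.congr_fun ((norm_map_iff_adjoint_comp_self A).1 hA) x

/-- Reading off the coefficients of `x` recovers the element related to it. -/
theorem eventually_sum_eq_of_mem_evalOneRel {T : H →L[ℂ] H} (hT : ∀ x, ‖T x‖ = ‖x‖)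
    {p : H × H} (hp : p ∈ evalOneRel T) :
    ∀ᶠ M : ℕ in atTop,
      ∑ k ∈ range M, ((adjoint T ^ k) p.1 - T (adjoint T ((adjoint T ^ k) p.1))) = p.2 := by
  have hTT := adjoint_apply_apply_of_norm_map hT
  induction hp using Submodule.span_induction with
  | mem p hp =>
    obtain ⟨k, w, hw, rfl⟩ := hp
    have shift_down (j m : ℕ) : (adjoint T ^ j) ((T ^ (j + m)) w) = (T ^ m) w := by
      induction j with
      | zero => simp
      | succ j ih =>
        rw [pow_succ, show j + 1 + m = (j + m) + 1 by omega, pow_succ' T]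
        simp only [mul_apply_eq_comp, hTT, ih]
    filter_upwards [eventually_gt_atTop k] with M hM
    rw [sum_eq_single_of_mem k (mem_range.2 hM)]
    · have h := shift_down k 0
      simp only [add_zero, pow_zero, one_apply_eq_self] at h
      rw [h, hw, map_zero, sub_zero]
    · intro j _ hj
      rcases lt_or_gt_of_ne hj with h | h
      · obtain ⟨m, rfl⟩ := Nat.exists_eq_add_of_lt h
        rw [show j + m + 1 = j + (m + 1) by omega]
        simp only [shift_down, pow_succ' T, mul_apply_eq_comp, hTT, sub_self]
      · obtain ⟨m, rfl⟩ := Nat.exists_eq_add_of_lt h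
        have h := shift_down k 0
        simp only [add_zero, pow_zero, one_apply_eq_self] at h
        rw [show k + m + 1 = (m + 1) + k by omega, pow_add, pow_succ]
        simp only [mul_apply_eq_comp, h, hw, map_zero, sub_zero]
  | zero => simp
  | add p q _ _ hp hq =>
    filter_upwards [hp, hq] with M hp hq
    rw [Prod.snd_add, ← hp, ← hq, ← sum_add_distrib]
    refine sum_congr rfl fun k _ => ?_
    simp only [Prod.fst_add, map_add]
    abel
  | smul c p _ hp =>
    filter_upwards [hp] with M hp
    rw [Prod.smul_snd, ← hp, smul_sum]
    simp [smul_sub]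

theorem eq_of_mem_evalOneRel {T : H →L[ℂ] H} (hT : ∀ x, ‖T x‖ = ‖x‖) {x y z : H}
    (hy : (x, y) ∈ evalOneRel T) (hz : (x, z) ∈ evalOneRel T) : y = z := by
  obtain ⟨M, h₁, h₂⟩ := ((eventually_sum_eq_of_mem_evalOneRel hT hy).and
    (eventually_sum_eq_of_mem_evalOneRel hT hz)).exists
  exact h₁.symm.trans h₂

/-- Multiplication by an isometric factor `A` of `T = A * B` has symbol
`z ↦ (1 - T T^*) A + z B^*`, here evaluated at `z = 1`. -/
theorem map_mem_evalOneRel {A B T : H →L[ℂ] H} (hAB : A * B = T) (hBA : B * A = T)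
    (hA : ∀ x, ‖A x‖ = ‖x‖) (hT : ∀ x, ‖T x‖ = ‖x‖) {p : H × H} (hp : p ∈ evalOneRel T) :
    (A p.1, A p.2 - T (adjoint T (A p.2)) + adjoint B p.2) ∈ evalOneRel T := by
  induction hp using Submodule.span_induction with
  | mem p hp =>
    obtain ⟨k, w, hw, rfl⟩ := hp
    have hAT : Commute A T := by
      rw [Commute, SemiconjBy, ← hAB, mul_assoc, hBA, hAB]
    have hTB : B * T = T * B := by rw [← hBA, mul_assoc, hAB, hBA]
    have hTA : adjoint T (A w) = adjoint B w := by
      rw [← hAB, ← star_eq_adjoint, star_mul]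
      simp [star_eq_adjoint, adjoint_apply_apply_of_norm_map hA]
    have hBw : adjoint T (adjoint B w) = 0 := by
      have h := congrArg (fun S : H →L[ℂ] H => star S w) hTB
      simp only [star_mul, star_eq_adjoint, mul_apply_eq_comp, hw, map_zero] at h
      exact h
    have hAw : adjoint T (A w - T (adjoint B w)) = 0 := by
      rw [map_sub, adjoint_apply_apply_of_norm_map hT, hTA, sub_self]
    have key := (evalOneRel T).add_mem (pow_mem_evalOneRel k hAw)
      (pow_mem_evalOneRel (k + 1) hBw)
    have hcomm : A ((T ^ k) w) = (T ^ k) (A w) :=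
      DFunLike.congr_fun (hAT.pow_right k).eq w
    simpa only [Prod.mk_add_mk, pow_succ, mul_apply_eq_comp, hTA, hcomm, ← map_add,
      sub_add_cancel] using key
  | zero =>
    simp only [Prod.fst_zero, Prod.snd_zero, map_zero, sub_zero, add_zero]
    exact (evalOneRel T).zero_mem
  | add p q _ _ hp hq =>
    convert (evalOneRel T).add_mem hp hq using 1
    ext <;> simp only [Prod.fst_add, Prod.snd_add, map_add]
    abel
  | smul c p _ hp =>
    convert (evalOneRel T).smul_mem c hp using 1
    ext <;> simp [smul_sub]

theorem wProj_apply {n : ℕ} {V : Fin n → H →L[ℂ] H} (hiso : ∀ i x, ‖V i x‖ = ‖x‖)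
    (hcomm : ∀ i j, Commute (V i) (V j)) (s : Finset (Fin n)) (x : H) :
    wProj V hcomm s x = x - opProd V hcomm s (adjoint (opProd V hcomm s) x) := by
  have : CompleteSpace (wSub V hcomm s) :=
    (ContinuousLinearMap.isClosed_ker _).completeSpace_coe
  refine Submodule.eq_starProjection_of_mem_of_inner_eq_zero (K := wSub V hcomm s) ?_ ?_
  · change adjoint (opProd V hcomm s) _ = 0
    rw [map_sub, adjoint_apply_apply_of_norm_map (norm_opProd_apply hiso hcomm s), sub_self]
  · intro w hw
    have hw : adjoint (opProd V hcomm s) w = 0 := hw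
    rw [sub_sub_cancel, ← adjoint_inner_right, hw, inner_zero_right]

end

/-- For every `η ∈ W = ker V^*`, the composition `U_1 (U_2 (⋯ (U_n η)))` equals `η`. -/
theorem stmt6 {H : Type*} [NormedAddCommGroup H] [InnerProductSpace ℂ H] [CompleteSpace H]
    {n : ℕ} (hn : 2 ≤ n) (V : Fin n → H →L[ℂ] H)
    (hiso : ∀ i x, ‖V i x‖ = ‖x‖) (hcomm : ∀ i j, Commute (V i) (V j))
    (hshift : ∀ x : H,
      Tendsto (fun m : ℕ => ((ContinuousLinearMap.adjoint (opProd V hcomm Finset.univ)) ^ m) x)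
        atTop (nhds 0))
    (η : H) (hη : η ∈ wSub V hcomm Finset.univ) :
    (List.ofFn (Uop V hcomm)).prod η = η := by
  have hT := norm_opProd_apply hiso hcomm univ
  have hη : adjoint (opProd V hcomm univ) η = 0 := hη
  have step (l : List (Fin n)) : ((l.map V).prod η, (l.map (Uop V hcomm)).prod η) ∈
      evalOneRel (opProd V hcomm univ) := by
    induction l with
    | nil => simpa using pow_mem_evalOneRel 0 hη
    | cons i l ih =>
      have hAB : V i * opProd V hcomm (univ.erase i) = opProd V hcomm univ :=
        mul_noncommProd_erase univ (mem_univ i) V _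
      have hBA : opProd V hcomm (univ.erase i) * V i = opProd V hcomm univ :=
        noncommProd_erase_mul univ (mem_univ i) V _
      simpa [Uop, wProj_apply hiso] using map_mem_evalOneRel hAB hBA (hiso i) hT ih
  have hprod : opProd V hcomm univ = ((List.finRange n).map V).prod := by
    rw [← noncommProd_toFinset _ V (fun a _ b _ _ => hcomm a b) (List.nodup_finRange n)]
    exact noncommProd_congr (by ext; simp) (fun _ _ => rfl) _
  have h := step (List.finRange n)
  rw [← hprod, ← List.ofFn_eq_map] at h
  exact eq_of_mem_evalOneRel hT h (by simpa using pow_mem_evalOneRel 1 hη)
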